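/- Let 𝔽 be an algebraically closed field of characteristic zero containing a square root i of −1, let n = 2, and let h ∈ R* be the vertex model defined on monomials by h(x) = 1, h(y) = i, and h(μ) = 0 for every other monomial μ (including the constant monomial 1), where x = x_1 and y = x_2. Then: (a) f_h(G) = 0 for every graph G with at least one vertex; (b) Stab(h) consists only of the identity of O_2; and consequently (c) the rank of M_{f_h,1} equals 0, which is strictly less than dim V^{Stab(h)} = 2. -/

import Mathlib

/-!
Formalization framework for "Partition functions of vertex models /
edge connection matrices" (Regts–Draisma style).

Graphs and fragments are finite multigraphs (allowing multiple edges, loops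
and circles); a `k`-fragment additionally has `k` labelled open ends.  We
encode a `k`-fragment by a number `nv` of internal vertices, a number `ne`
of edges, and for each edge the multiset of its endpoints, each endpoint
being either an internal vertex (`Sum.inl`) or an open-end label
(`Sum.inr`).  Every edge has `2` endpoints (counted with multiplicity; a
loop at `v` lists `v` twice) or `0` endpoints (a circle), and every label
occurs exactly once in total (the open ends have degree one).
-/

open MvPolynomial

namespace VertexModels

noncomputable section

/-- A `k`-fragment. For `k = 0` this is a graph. -/
structure Fragment (k : ℕ) : Type where
  nv : ℕ
  ne : ℕ
  inc : Fin ne → Multiset (Fin nv ⊕ Fin k)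
  card_inc : ∀ e, Multiset.card (inc e) = 2 ∨ Multiset.card (inc e) = 0
  openEnd : ∀ j : Fin k, (∑ e, (inc e).count (Sum.inr j)) = 1

/-- A graph: a `0`-fragment. -/
abbrev Graph := Fragment 0

/-- The basic `k`-fragment `F_k`: one internal vertex joined to each of the
`k` open ends by a half edge. -/
def basicFragment (k : ℕ) : Fragment k where
  nv := 1
  ne := k
  inc := fun e => {Sum.inl 0, Sum.inr e}
  card_inc := fun e => Or.inl (by simp)
  openEnd := fun j => by
    have h : ∀ e : Fin k,
        Multiset.count (Sum.inr j) ({Sum.inl 0, Sum.inr e} : Multiset (Fin 1 ⊕ Fin k))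
          = if j = e then 1 else 0 := by
      intro e
      by_cases he : j = e <;>
        simp [Multiset.count_cons, Multiset.count_singleton, he]
    simp only [h]
    simp

variable {𝔽 : Type} [Field 𝔽] {n : ℕ}

/-- A vertex model: a linear functional on `R = 𝔽[x_1, …, x_n]`. -/
abbrev VertexModel (𝔽 : Type) [Field 𝔽] (n : ℕ) : Type :=
  MvPolynomial (Fin n) 𝔽 →ₗ[𝔽] 𝔽

/-- The monomial `∏_{e ∈ δ(v)} x_{ψ(e)}` seen by the internal vertex `v` of a
fragment under the edge colouring `ψ`. -/
def monomialAt {k : ℕ} (F : Fragment k) (ψ : Fin F.ne → Fin n) (v : Fin F.nv) :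
    MvPolynomial (Fin n) 𝔽 :=
  ∏ e, (X (ψ e) : MvPolynomial (Fin n) 𝔽) ^ ((F.inc e).count (Sum.inl v))

/-- The partition function `f_h` of the vertex model `h`. -/
def partitionFun (h : VertexModel 𝔽 n) (G : Graph) : 𝔽 :=
  ∑ ψ : Fin G.ne → Fin n, ∏ v, h (monomialAt G ψ v)

/-- `h_φ(F)`, for a `k`-fragment `F` and a colouring `φ` of the open ends. -/
def hphi (h : VertexModel 𝔽 n) {k : ℕ} (F : Fragment k) (φ : Fin k → Fin n) : 𝔽 :=
  ∑ ψ ∈ Finset.univ.filter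
      (fun ψ : Fin F.ne → Fin n => ∀ (e : Fin F.ne) (j : Fin k),
        Sum.inr j ∈ F.inc e → ψ e = φ j),
    ∏ v, h (monomialAt F ψ v)

/-- `V^{⊗ k}` in coordinates: functions on multi-indices, with basis
`e_φ`. -/
abbrev Tensor (𝔽 : Type) [Field 𝔽] (n k : ℕ) : Type := (Fin k → Fin n) → 𝔽

/-- The tensor `p_h(F) = ∑_φ h_φ(F) e_φ ∈ V^{⊗ k}`. -/
def ph (h : VertexModel 𝔽 n) {k : ℕ} (F : Fragment k) : Tensor 𝔽 n k :=
  fun φ => hphi h F φ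

/-- The standard bilinear form on `V^{⊗ k}`. -/
def tpair {k : ℕ} (t s : Tensor 𝔽 n k) : 𝔽 := ∑ φ, t φ * s φ

/-- Tensor product `V^{⊗ k} × V^{⊗ l} → V^{⊗ (k+l)}`. -/
def tmul {k l : ℕ} (t : Tensor 𝔽 n k) (s : Tensor 𝔽 n l) : Tensor 𝔽 n (k + l) :=
  fun φ => t (fun i => φ (Fin.castAdd l i)) * s (fun i => φ (Fin.natAdd k i))

/-- The contraction `C^k_{i,j} : V^{⊗ k} → V^{⊗ (k-2)}` (here `k = m + 2`),
contracting the `i`-th and `j`-th tensor factors (`i < j`). -/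
def tcontract {m : ℕ} (i j : Fin (m + 2)) (t : Tensor 𝔽 n (m + 2)) : Tensor 𝔽 n m :=
  fun φ => ∑ c : Fin n,
    t (Fin.insertNth i c (Fin.insertNth (⟨j.1 - 1, by have := j.isLt; omega⟩ : Fin (m + 1)) c φ))

/-- The orthogonal group `O_n`, as the set of matrices `g` with `gᵀ g = 1`. -/
def orthSet (𝔽 : Type) [Field 𝔽] (n : ℕ) : Set (Matrix (Fin n) (Fin n) 𝔽) :=
  {g | g.transpose * g = 1}

/-- Substitution `X i ↦ ∑ j, g i j • X j`, i.e. composition of a polynomial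
with the linear map `g`, as a linear endomorphism of `R`. -/
noncomputable def polSub (g : Matrix (Fin n) (Fin n) 𝔽) :
    MvPolynomial (Fin n) 𝔽 →ₗ[𝔽] MvPolynomial (Fin n) 𝔽 :=
  (MvPolynomial.aeval (fun i => ∑ j, MvPolynomial.C (g i j) * X j)).toLinearMap

/-- The action of `g ∈ O_n` on vertex models: `(g h)(p) = h (p ∘ g) = h(g⁻¹ • p)`. -/
noncomputable def dualAct (g : Matrix (Fin n) (Fin n) 𝔽) (h : VertexModel 𝔽 n) :
    VertexModel 𝔽 n :=
  h.comp (polSub g)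

/-- The stabilizer `Stab(h) = {g ∈ O_n ∣ g h = h}`. -/
noncomputable def Stab (h : VertexModel 𝔽 n) : Set (Matrix (Fin n) (Fin n) 𝔽) :=
  {g | g ∈ orthSet 𝔽 n ∧ dualAct g h = h}

/-- The diagonal action of a matrix `g` on `V^{⊗ k}`. -/
def tact (g : Matrix (Fin n) (Fin n) 𝔽) (k : ℕ) :
    Tensor 𝔽 n k →ₗ[𝔽] Tensor 𝔽 n k :=
  Matrix.mulVecLin (Matrix.of fun φ ψ : Fin k → Fin n => ∏ i, g (φ i) (ψ i))

/-- The subspace `(V^{⊗ k})^S` of tensors fixed by every element of a set `S`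
of matrices. -/
def invSub (S : Set (Matrix (Fin n) (Fin n) 𝔽)) (k : ℕ) :
    Submodule 𝔽 (Tensor 𝔽 n k) where
  carrier := {t | ∀ g ∈ S, tact g k t = t}
  add_mem' := fun {a b} ha hb => by
    intro g hg
    rw [map_add, ha g hg, hb g hg]
  zero_mem' := by
    intro g hg
    rw [map_zero]
  smul_mem' := fun c a ha => by
    intro g hg
    rw [map_smul, ha g hg]

/-! ### Gluing two `k`-fragments into a graph -/

/-- `touches F H j a`: the edge `a` of the disjoint union of `F` and `H` is
incident with the open end labelled `j` (of its own fragment). -/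
def touches {k : ℕ} (F H : Fragment k) (j : Fin k) : Fin F.ne ⊕ Fin H.ne → Prop
  | .inl e => Sum.inr j ∈ F.inc e
  | .inr e => Sum.inr j ∈ H.inc e

/-- Edges of `F` and `H` which get merged into a single edge of `F * H` are
identified by the equivalence generated by sharing an open-end label. -/
def glueSetoid {k : ℕ} (F H : Fragment k) : Setoid (Fin F.ne ⊕ Fin H.ne) :=
  Relation.EqvGen.setoid (fun a b => ∃ j, touches F H j a ∧ touches F H j b)

/-- Number of edges of the glued graph `F * H`. -/
noncomputable def glueNE {k : ℕ} (F H : Fragment k) : ℕ :=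
  Nat.card (Quotient (glueSetoid F H))

noncomputable def glueEquiv {k : ℕ} (F H : Fragment k) :
    Fin (glueNE F H) ≃ Quotient (glueSetoid F H) :=
  (Finite.equivFin _).symm

/-- The internal (non-open-end) endpoints of an edge of the disjoint union,
re-indexed in `Fin (F.nv + H.nv)`. -/
def intEnds {k : ℕ} (F H : Fragment k) :
    Fin F.ne ⊕ Fin H.ne → Multiset (Fin (F.nv + H.nv) ⊕ Fin 0)
  | .inl e => (F.inc e).filterMap fun x =>
      match x with
      | .inl v => some (Sum.inl (Fin.castAdd H.nv v))
      | .inr _ => none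
  | .inr e => (H.inc e).filterMap fun x =>
      match x with
      | .inl v => some (Sum.inl (Fin.natAdd F.nv v))
      | .inr _ => none

/-- Endpoints of an edge of the glued graph: the internal endpoints of all
edges merged into it. -/
noncomputable def glueInc {k : ℕ} (F H : Fragment k) (c : Fin (glueNE F H)) :
    Multiset (Fin (F.nv + H.nv) ⊕ Fin 0) := by
  classical
  exact ∑ a ∈ Finset.univ.filter
    (fun a => Quotient.mk (glueSetoid F H) a = glueEquiv F H c), intEnds F H a

/-- The glued graph `F * H` of two `k`-fragments: connect the half edges
with equally labelled open ends into single edges (chains of half edges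
closing up produce circles).  (The impossible degenerate branch is never
taken.) -/
noncomputable def glue {k : ℕ} (F H : Fragment k) : Graph := by
  classical
  exact if hc : ∀ c, Multiset.card (glueInc F H c) = 2 ∨ Multiset.card (glueInc F H c) = 0 then
    { nv := F.nv + H.nv
      ne := glueNE F H
      inc := glueInc F H
      card_inc := hc
      openEnd := fun j => j.elim0 }
  else basicFragment 0

/-- The rank of the edge connection matrix `M_{f_h,k}` : the dimension of the
span of its rows. -/
noncomputable def connectionRank (h : VertexModel 𝔽 n) (k : ℕ) : ℕ :=
  Module.finrank 𝔽 (Submodule.span 𝔽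
    (Set.range fun F : Fragment k => fun H : Fragment k => partitionFun h (glue F H)))

/-! ### The algebra `𝒜` of formal linear combinations of fragments -/

/-- `p_h` on formal linear combinations `𝔽ℱ_k` of `k`-fragments. -/
noncomputable def phL (h : VertexModel 𝔽 n) (k : ℕ) :
    (Fragment k →₀ 𝔽) →ₗ[𝔽] Tensor 𝔽 n k :=
  Finsupp.linearCombination 𝔽 (fun F : Fragment k => ph h F)

/-- `γ ↦ (F ↦ f_h(γ * F))`: the bilinear extension of gluing followed by the
partition function.  Its kernel is `I_k`. -/
noncomputable def glueRow (h : VertexModel 𝔽 n) (k : ℕ) :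
    (Fragment k →₀ 𝔽) →ₗ[𝔽] (Fragment k → 𝔽) :=
  Finsupp.linearCombination 𝔽
    (fun F : Fragment k => fun H : Fragment k => partitionFun h (glue F H))

/-- A vertex model is nondegenerate if `ker p_h = I`. -/
def Nondeg (h : VertexModel 𝔽 n) : Prop :=
  ∀ (k : ℕ) (γ : Fragment k →₀ 𝔽), phL h k γ = 0 ↔ glueRow h k γ = 0

/-! ### The product of fragments and the contraction of fragments -/

/-- Endpoint multisets of the disjoint union `F H` of fragments (`H`'s open
ends relabelled by `i ↦ k + i`). -/
def mulInc {k l : ℕ} (F : Fragment k) (H : Fragment l) :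
    Fin (F.ne + H.ne) → Multiset (Fin (F.nv + H.nv) ⊕ Fin (k + l)) :=
  Fin.addCases
    (fun e => (F.inc e).map (Sum.map (Fin.castAdd H.nv) (Fin.castAdd l)))
    (fun e => (H.inc e).map (Sum.map (Fin.natAdd F.nv) (Fin.natAdd k)))

/-- The product `F H` in the fragment algebra `𝒜`: disjoint union, with the
open ends of `H` relabelled `i ↦ k + i`.  (The impossible degenerate branch
is never taken.) -/
noncomputable def fragMul {k l : ℕ} (F : Fragment k) (H : Fragment l) :
    Fragment (k + l) := by
  classical
  exact if hc : (∀ e, Multiset.card (mulInc F H e) = 2 ∨ Multiset.card (mulInc F H e) = 0)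
      ∧ (∀ j : Fin (k + l), (∑ e, (mulInc F H e).count (Sum.inr j)) = 1) then
    { nv := F.nv + H.nv
      ne := F.ne + H.ne
      inc := mulInc F H
      card_inc := hc.1
      openEnd := hc.2 }
  else basicFragment (k + l)

/-- Relabelling map for labels after removing labels `i` and `j` (`i < j`),
preserving the order of the remaining labels. -/
def downLabel {m : ℕ} (i j l : Fin (m + 2)) (hij : i < j) (h : ¬(l = i ∨ l = j)) : Fin m :=
  ⟨l.1 - (if i.1 < l.1 then 1 else 0) - (if j.1 < l.1 then 1 else 0), by
    push_neg at h
    have h1 : l.1 ≠ i.1 := fun hh => h.1 (Fin.ext hh)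
    have h2 : l.1 ≠ j.1 := fun hh => h.2 (Fin.ext hh)
    have h3 : i.1 < j.1 := hij
    have h4 := l.isLt
    have h6 := j.isLt
    split_ifs <;> omega⟩

/-- Removing the open ends `i` and `j` from an endpoint multiset and
relabelling the remaining open ends. -/
def removeEnd {m nv : ℕ} (i j : Fin (m + 2)) (hij : i < j) :
    Fin nv ⊕ Fin (m + 2) → Option (Fin nv ⊕ Fin m)
  | .inl v => some (.inl v)
  | .inr l => if h : l = i ∨ l = j then none else some (.inr (downLabel i j l hij h))

/-- Edges merged by the contraction `Γ^k_{i,j}`: those incident with the open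
end `i` or the open end `j`. -/
def contractSetoid {m : ℕ} (F : Fragment (m + 2)) (i j : Fin (m + 2)) :
    Setoid (Fin F.ne) :=
  Relation.EqvGen.setoid (fun e e' =>
    (Sum.inr i ∈ F.inc e ∨ Sum.inr j ∈ F.inc e) ∧
    (Sum.inr i ∈ F.inc e' ∨ Sum.inr j ∈ F.inc e'))

noncomputable def contractNE {m : ℕ} (F : Fragment (m + 2)) (i j : Fin (m + 2)) : ℕ :=
  Nat.card (Quotient (contractSetoid F i j))

noncomputable def contractEquiv {m : ℕ} (F : Fragment (m + 2)) (i j : Fin (m + 2)) :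
    Fin (contractNE F i j) ≃ Quotient (contractSetoid F i j) :=
  (Finite.equivFin _).symm

noncomputable def contractInc {m : ℕ} (F : Fragment (m + 2)) (i j : Fin (m + 2))
    (hij : i < j) (c : Fin (contractNE F i j)) : Multiset (Fin F.nv ⊕ Fin m) := by
  classical
  exact ∑ e ∈ Finset.univ.filter
    (fun e => Quotient.mk (contractSetoid F i j) e = contractEquiv F i j c),
    (F.inc e).filterMap (removeEnd i j hij)

/-- The contraction `Γ^k_{i,j}(F)` of a `(m+2)`-fragment: join the half edges
at the open ends labelled `i` and `j` into a single edge (possibly a circle)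
and relabel the remaining open ends preserving their order.  (The impossible
degenerate branch is never taken.) -/
noncomputable def fragContract {m : ℕ} (i j : Fin (m + 2)) (hij : i < j)
    (F : Fragment (m + 2)) : Fragment m := by
  classical
  exact if hc : (∀ c, Multiset.card (contractInc F i j hij c) = 2 ∨
        Multiset.card (contractInc F i j hij c) = 0)
      ∧ (∀ jj : Fin m, (∑ c, (contractInc F i j hij c).count (Sum.inr jj)) = 1) then
    { nv := F.nv
      ne := contractNE F i j
      inc := contractInc F i j hij
      card_inc := hc.1
      openEnd := hc.2 }
  else basicFragment m

/-! ### Zariski closedness, spin models, reductivity -/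

/-- A subset of a coordinate space `ι → 𝔽` is Zariski closed if it is the
common zero locus of a set of polynomials. -/
def IsZarClosed {ι : Type} (S : Set (ι → 𝔽)) : Prop :=
  ∃ P : Set (MvPolynomial ι 𝔽), S = {x | ∀ p ∈ P, MvPolynomial.eval x p = 0}

/-- The vertex model `h(p) = ∑ i, a i • p (u i)` attached to points
`u_1, …, u_m` and coefficients `a_1, …, a_m`. -/
noncomputable def spinModel {m : ℕ} (u : Fin m → (Fin n → 𝔽)) (a : Fin m → 𝔽) :
    VertexModel 𝔽 n :=
  ∑ i, a i • (MvPolynomial.aeval (u i) : MvPolynomial (Fin n) 𝔽 →ₐ[𝔽] 𝔽).toLinearMap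

/-- Multi-degrees of total degree at most `e`: coordinates for the space
`(R_{≤ e})^*`. -/
def LowDeg (n e : ℕ) : Type := {d : Fin n →₀ ℕ // (d.sum fun _ c => c) ≤ e}

/-- The `O_n`-orbit of `h_e` (the restriction of `h` to polynomials of degree
at most `e`), in coordinates. -/
noncomputable def restOrbit (h : VertexModel 𝔽 n) (e : ℕ) : Set (LowDeg n e → 𝔽) :=
  {y | ∃ g ∈ orthSet 𝔽 n, ∀ d : LowDeg n e,
    y d = dualAct g h (MvPolynomial.monomial d.1 (1 : 𝔽))}

/-- The `O_n`-orbit of an `m`-tuple of vectors, in coordinates. -/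
def vecOrbit {m : ℕ} (u : Fin m → (Fin n → 𝔽)) : Set (Fin m × Fin n → 𝔽) :=
  {y | ∃ g ∈ orthSet 𝔽 n, ∀ p : Fin m × Fin n, y p = g.mulVec (u p.1) p.2}

/-- The `O_n`-orbit of an element `w` of `⊕_{k ≤ e} V^{⊗ k}`, in
coordinates. -/
def tensorTupleOrbit (e : ℕ) (w : ∀ k : ℕ, Tensor 𝔽 n k) :
    Set ((Σ p : Fin (e + 1), (Fin p.1 → Fin n)) → 𝔽) :=
  {y | ∃ g ∈ orthSet 𝔽 n, ∀ q : Σ p : Fin (e + 1), (Fin p.1 → Fin n),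
    y q = tact g q.1 (w q.1) q.2}

/-- Linear reductivity of a set `H` of `n × n` matrices: in every
polynomial representation of `H`, every `H`-invariant subspace admits an
`H`-invariant complement. -/
def IsLinRed (H : Set (Matrix (Fin n) (Fin n) 𝔽)) : Prop :=
  ∀ (m : ℕ) (ρ : Matrix (Fin n) (Fin n) 𝔽 → Matrix (Fin m) (Fin m) 𝔽),
    (∀ a b : Fin m, ∃ p : MvPolynomial (Fin n × Fin n) 𝔽,
      ∀ g, ρ g a b = MvPolynomial.eval (fun q => g q.1 q.2) p) →
    (∀ g ∈ H, ∀ g' ∈ H, ρ (g * g') = ρ g * ρ g') → ρ 1 = 1 →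
    ∀ W : Submodule 𝔽 (Fin m → 𝔽),
      (∀ g ∈ H, ∀ w ∈ W, (ρ g).mulVec w ∈ W) →
      ∃ W' : Submodule 𝔽 (Fin m → 𝔽), IsCompl W W' ∧
        (∀ g ∈ H, ∀ w ∈ W', (ρ g).mulVec w ∈ W')

/-- The pointwise stabilizer in `O_n` of a graded family of subspaces of the
tensor algebra. -/
def setStab (A : ∀ k : ℕ, Submodule 𝔽 (Tensor 𝔽 n k)) :
    Set (Matrix (Fin n) (Fin n) 𝔽) :=
  {g | g ∈ orthSet 𝔽 n ∧ ∀ (k : ℕ), ∀ a ∈ A k, tact g k a = a}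

/-- The sum of the nontrivial `H`-isotypic components of `V^{⊗ k}`: the
largest `H`-stable subspace meeting the invariants trivially. -/
def nontrivialPart (H : Set (Matrix (Fin n) (Fin n) 𝔽)) (k : ℕ) :
    Submodule 𝔽 (Tensor 𝔽 n k) :=
  sSup {W | (∀ g ∈ H, ∀ w ∈ W, tact g k w ∈ W) ∧ W ⊓ invSub H k = ⊥}

end

end VertexModels

open VertexModels

/-- The `2`-colour vertex model with `h(x) = 1`, `h(y) = i` and `h(μ) = 0` on
all other monomials `μ`. -/
noncomputable def exampleModel (𝔽 : Type) [Field 𝔽] (i : 𝔽) : VertexModel 𝔽 2 where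
  toFun := fun p => MvPolynomial.coeff (Finsupp.single (0 : Fin 2) 1) p
    + i * MvPolynomial.coeff (Finsupp.single (1 : Fin 2) 1) p
  map_add' := by
    intro p q
    simp [MvPolynomial.coeff_add]
    ring
  map_smul' := by
    intro c p
    simp [MvPolynomial.coeff_smul]
    ring

section ExampleModel

variable {𝔽 : Type} [Field 𝔽]

/-- The values of the example vertex model on the variables. -/
def exampleWeight (i : 𝔽) : Fin 2 → 𝔽 := ![1, i]

lemma exampleModel_X (i : 𝔽) (a : Fin 2) : exampleModel 𝔽 i (X a) = exampleWeight i a := by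
  fin_cases a <;>
    simp [exampleModel, exampleWeight, coeff_X, Finsupp.single_left_inj]

lemma exampleModel_sum_C_mul_X (i : 𝔽) (c : Fin 2 → 𝔽) :
    exampleModel 𝔽 i (∑ j, C (c j) * X j) = c 0 + i * c 1 := by
  simp only [Fin.sum_univ_two, C_mul', map_add, map_smul, exampleModel_X, smul_eq_mul]
  simp [exampleWeight, mul_comm]

lemma exampleModel_eq_zero_of_isHomogeneous (i : 𝔽) {p : MvPolynomial (Fin 2) 𝔽} {d : ℕ}
    (hp : p.IsHomogeneous d) (hd : d ≠ 1) : exampleModel 𝔽 i p = 0 := by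
  have h (a : Fin 2) : coeff (Finsupp.single a 1) p = 0 :=
    hp.coeff_eq_zero (by simpa using hd.symm)
  simp [exampleModel, h]

/-- The example vertex model is multiplicative on monomials of degree one and vanishes on all
other monomials. -/
lemma exampleModel_prod_X_pow (i : 𝔽) {m : ℕ} (ψ : Fin m → Fin 2) (c : Fin m → ℕ) :
    exampleModel 𝔽 i (∏ e, X (ψ e) ^ c e) =
      if ∑ e, c e = 1 then ∏ e, exampleWeight i (ψ e) ^ c e else 0 := by
  split_ifs with h
  · obtain ⟨e₀, h₁, h₀⟩ : ∃ e₀, c e₀ = 1 ∧ ∀ e ≠ e₀, c e = 0 := by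
      obtain ⟨e₀, -, hne⟩ := Finset.exists_ne_zero_of_sum_ne_zero (h.trans_ne one_ne_zero)
      rw [← Finset.add_sum_erase _ _ (Finset.mem_univ e₀)] at h
      have hrest : ∑ e ∈ Finset.univ.erase e₀, c e = 0 := by omega
      exact ⟨e₀, by omega, fun e he => Finset.sum_eq_zero_iff.mp hrest e (by simpa using he)⟩
    rw [Finset.prod_eq_single e₀ (fun e _ he => by simp [h₀ e he]) (by simp),
      Finset.prod_eq_single e₀ (fun e _ he => by simp [h₀ e he]) (by simp), h₁, pow_one,
      pow_one, exampleModel_X]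
  · refine exampleModel_eq_zero_of_isHomogeneous i (IsHomogeneous.prod _ _ c fun e _ => ?_) h
    simpa using (isHomogeneous_X 𝔽 (ψ e)).pow (c e)

lemma sum_count_inl_eq_card (G : Graph) (e : Fin G.ne) :
    ∑ v, (G.inc e).count (Sum.inl v) = Multiset.card (G.inc e) := by
  rw [← Multiset.sum_count_eq_card (s := Finset.univ) fun a _ => Finset.mem_univ a,
    Fintype.sum_sum_type]
  simp

lemma partitionFun_exampleModel_eq_zero {i : 𝔽} (hi : i ^ 2 = -1) (G : Graph) (hG : 0 < G.nv) :
    partitionFun (exampleModel 𝔽 i) G = 0 := by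
  simp only [partitionFun, monomialAt, exampleModel_prod_X_pow]
  by_cases hdeg : ∀ v, ∑ e, (G.inc e).count (Sum.inl v) = 1
  · simp only [hdeg, if_true]
    have hprod (ψ : Fin G.ne → Fin 2) :
        ∏ v, ∏ e, exampleWeight i (ψ e) ^ (G.inc e).count (Sum.inl v) =
          ∏ e, exampleWeight i (ψ e) ^ Multiset.card (G.inc e) := by
      rw [Finset.prod_comm]
      simp only [Finset.prod_pow_eq_pow_sum, sum_count_inl_eq_card]
    obtain ⟨e₀, -, he₀⟩ : ∃ e ∈ Finset.univ, (G.inc e).count (Sum.inl ⟨0, hG⟩) ≠ 0 :=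
      Finset.exists_ne_zero_of_sum_ne_zero (by simp [hdeg])
    have hcard : Multiset.card (G.inc e₀) = 2 :=
      (G.card_inc e₀).resolve_right fun h => he₀ (by simp [Multiset.card_eq_zero.mp h])
    simp only [hprod]
    rw [← Fintype.prod_sum fun e a => exampleWeight i a ^ Multiset.card (G.inc e)]
    exact Finset.prod_eq_zero (Finset.mem_univ e₀) (by simp [hcard, exampleWeight, hi])
  · push Not at hdeg
    obtain ⟨v, hv⟩ := hdeg
    exact Finset.sum_eq_zero fun ψ _ => Finset.prod_eq_zero (Finset.mem_univ v) (if_neg hv)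

lemma stab_exampleModel [CharZero 𝔽] {i : 𝔽} (hi : i ^ 2 = -1) :
    Stab (exampleModel 𝔽 i) = {(1 : Matrix (Fin 2) (Fin 2) 𝔽)} := by
  ext g
  rw [Set.mem_singleton_iff]
  constructor
  · rintro ⟨horth, hstab⟩
    have hfix (a : Fin 2) : g a 0 + i * g a 1 = exampleWeight i a := by
      rw [← exampleModel_sum_C_mul_X, ← exampleModel_X]
      simpa [dualAct, polSub] using LinearMap.congr_fun hstab (X a)
    have h0 : g 0 0 + i * g 0 1 = 1 := hfix 0
    have h1 : g 1 0 + i * g 1 1 = i := hfix 1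
    have hcol (a : Fin 2) : g 0 a * g 0 a + g 1 a * g 1 a = 1 := by
      simpa [Matrix.mul_apply] using congrFun₂ horth a a
    have hi0 : i ≠ 0 := by
      rintro rfl
      simp at hi
    have hd : g 1 1 = 1 + i * g 0 1 := by
      have h2 : (2 : 𝔽) * (g 1 1 - (1 + i * g 0 1)) = 0 := by
        have h := hcol 0
        rw [eq_sub_of_add_eq h0, eq_sub_of_add_eq h1] at h
        linear_combination h + hcol 1 - (g 0 1 ^ 2 + (1 - g 1 1) ^ 2) * hi
      linear_combination (mul_eq_zero.mp h2).resolve_left two_ne_zero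
    have hb : g 0 1 = 0 := by
      have h2 : (2 * i) * g 0 1 = 0 := by
        have := hcol 1
        rw [hd] at this
        linear_combination this - g 0 1 ^ 2 * hi
      exact (mul_eq_zero.mp h2).resolve_left (mul_ne_zero two_ne_zero hi0)
    rw [hb, mul_zero, add_zero] at hd h0
    have hc : g 1 0 = 0 := by rw [hd] at h1; linear_combination h1
    ext a b
    fin_cases a <;> fin_cases b <;> simp [h0, hb, hc, hd]
  · rintro rfl
    refine ⟨by simp [orthSet], ?_⟩
    have h (a : Fin 2) :
        ∑ j, C ((1 : Matrix (Fin 2) (Fin 2) 𝔽) a j) * X j = (X a : MvPolynomial (Fin 2) 𝔽) := by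
      simp [Matrix.one_apply, apply_ite C, ite_mul]
    ext1 p
    simp [dualAct, polSub, h]

lemma VertexModels.Fragment.nv_pos (F : Fragment 1) : 0 < F.nv := by
  by_contra hn
  have : IsEmpty (Fin F.nv) := ⟨fun v => hn v.pos⟩
  have hcount (e : Fin F.ne) : (F.inc e).count (Sum.inr 0) = Multiset.card (F.inc e) := by
    rw [← Multiset.sum_count_eq_card (s := Finset.univ) fun a _ => Finset.mem_univ a]
    rw [Fintype.sum_sum_type]
    simp
  have hsum := F.openEnd 0
  simp only [hcount] at hsum
  have heven : 2 ∣ ∑ e, Multiset.card (F.inc e) :=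
    Finset.dvd_sum fun e _ => by rcases F.card_inc e with h | h <;> simp [h]
  omega

lemma glue_nv_pos (F H : Fragment 1) : 0 < (glue F H).nv := by
  unfold glue
  split_ifs
  · exact Nat.add_pos_left F.nv_pos _
  · exact Nat.one_pos

lemma connectionRank_exampleModel {i : 𝔽} (hi : i ^ 2 = -1) :
    connectionRank (exampleModel 𝔽 i) 1 = 0 := by
  have h (F H : Fragment 1) : partitionFun (exampleModel 𝔽 i) (glue F H) = 0 :=
    partitionFun_exampleModel_eq_zero hi _ (glue_nv_pos F H)
  have hbot : Submodule.span 𝔽 (Set.range fun F H : Fragment 1 =>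
      partitionFun (exampleModel 𝔽 i) (glue F H)) = ⊥ := by
    rw [Submodule.span_eq_bot]
    rintro _ ⟨F, rfl⟩
    exact funext (h F)
  rw [connectionRank, hbot, finrank_bot]

lemma tact_one {n : ℕ} (k : ℕ) (t : Tensor 𝔽 n k) :
    tact (1 : Matrix (Fin n) (Fin n) 𝔽) k t = t := by
  have h : (Matrix.of fun φ ψ : Fin k → Fin n =>
      ∏ j, (1 : Matrix (Fin n) (Fin n) 𝔽) (φ j) (ψ j)) = 1 := by
    ext φ ψ
    simp [Matrix.one_apply, Finset.prod_ite_zero, funext_iff]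
  simp [tact, h]

lemma finrank_invSub_singleton_one (n k : ℕ) :
    Module.finrank 𝔽 (invSub {(1 : Matrix (Fin n) (Fin n) 𝔽)} k) = n ^ k := by
  have h : invSub {(1 : Matrix (Fin n) (Fin n) 𝔽)} k = ⊤ := by
    refine eq_top_iff.mpr fun t _ g hg => ?_
    rw [Set.mem_singleton_iff.mp hg, tact_one]
  rw [h, finrank_top]
  simp [Tensor]

end ExampleModel

/-- **Example 3**: for the vertex model `h` with `h(x) = 1`, `h(y) = i`
(`i² = -1`) and `h = 0` on all other monomials: `f_h` vanishes on every graph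
with at least one vertex, `Stab(h) = {1}`, and hence
`rk(M_{f_h,1}) = 0 < 2 = dim V^{Stab(h)}`. -/
theorem example_rank_lt_inv_dim (𝔽 : Type) [Field 𝔽] [IsAlgClosed 𝔽] [CharZero 𝔽]
    (i : 𝔽) (hi : i ^ 2 = -1) :
    (∀ G : Graph, 0 < G.nv → partitionFun (exampleModel 𝔽 i) G = 0) ∧
    Stab (exampleModel 𝔽 i) = {(1 : Matrix (Fin 2) (Fin 2) 𝔽)} ∧
    connectionRank (exampleModel 𝔽 i) 1 = 0 ∧
    Module.finrank 𝔽 (invSub (Stab (exampleModel 𝔽 i)) 1) = 2 := by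
  refine ⟨fun G hG => partitionFun_exampleModel_eq_zero hi G hG, stab_exampleModel hi,
    connectionRank_exampleModel hi, ?_⟩
  rw [stab_exampleModel hi, finrank_invSub_singleton_one, pow_one]
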